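/- Partial duality for the first Symanzik polynomial of the noncommutative heat-kernel theory: let G be a connected ribbon graph without flags and define U_G(α, θ) = Σ_{A ⊆ E(G), (A,V(G)) spanning quasi-tree} (θ/2)^{|A|−v(G)+1} Π_{e∉A} α_e. Then for every A ⊆ E(G), every real θ > 0 and every family of nonzero reals α_e, U_{G^{A}}(α, θ) = (θ/2)^{v(G)−v(G^{A})} (Π_{e∈A} 2α_e/θ) · U_G(α_A, θ), where [α_A]_e = θ²/(4α_e) if e ∈ A and [α_A]_e = α_e if e ∉ A. -/

import Mathlib

set_option linter.unusedSectionVars false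

open Finset

namespace RibbonPaper

variable {X : Type} [Fintype X] [DecidableEq X]

/-- Raw combinatorial data of a ribbon graph with flags: three permutations of
the finite set of crosses. -/
structure RawRibbon (X : Type) [Fintype X] [DecidableEq X] where
  s0 : Equiv.Perm X
  th : Equiv.Perm X
  s1 : Equiv.Perm X

namespace RawRibbon

/-- The axioms of a combinatorial map with flags (ribbon graph with flags). -/
def IsRibbon (G : RawRibbon X) : Prop :=
  G.th ^ 2 = 1 ∧ G.s1 ^ 2 = 1 ∧ G.th * G.s1 = G.s1 * G.th ∧
    (∀ x, G.th x ≠ x) ∧ (∀ x, G.th x ≠ G.s1 x) ∧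
    G.s0 * G.th = G.th * G.s0⁻¹ ∧
    ∀ (x : X) (n : ℤ), (G.s0 ^ n) x ≠ G.th x

/-- A ribbon graph without flags: `σ₁` is fixed-point free. -/
def NoFlags (G : RawRibbon X) : Prop := ∀ x, G.s1 x ≠ x

/-- The edges: 4-element orbits `{x, θx, σ₁x, σ₁θx}` of crosses not fixed by `σ₁`. -/
def edges (G : RawRibbon X) : Finset (Finset X) :=
  (Finset.univ.filter fun x => G.s1 x ≠ x).image
    fun x => ({x, G.th x, G.s1 x, G.s1 (G.th x)} : Finset X)

/-- The flags: pairs `{x, θ x}` of crosses fixed by `σ₁`. -/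
def flags (G : RawRibbon X) : Finset (Finset X) :=
  (Finset.univ.filter fun x => G.s1 x = x).image fun x => ({x, G.th x} : Finset X)

/-- The half-ribbons: all pairs `{x, θ x}`. -/
def halfRibbons (G : RawRibbon X) : Finset (Finset X) :=
  Finset.univ.image fun x => ({x, G.th x} : Finset X)

/-- Orbit of a point under a permutation, as a finset. -/
def permOrbit (f : Equiv.Perm X) (x : X) : Finset X :=
  (Finset.range (Fintype.card X)).image fun n => (f ^ n) x

/-- The vertex containing the cross `x`: the union of the `σ₀`-cycles of `x` and `θ x`. -/
def vertexOf (G : RawRibbon X) (x : X) : Finset X :=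
  permOrbit G.s0 x ∪ permOrbit G.s0 (G.th x)

/-- The vertices of the ribbon graph, as finsets of crosses. -/
def vertices (G : RawRibbon X) : Finset (Finset X) :=
  Finset.univ.image G.vertexOf

/-- `degB G B v` : the number of half-edges incident to `v` that belong to edges of `B`,
plus the number of flags incident to `v`. -/
def degB (G : RawRibbon X) (B : Finset (Finset X)) (v : Finset X) : ℕ :=
  (G.halfRibbons.filter fun h => h ⊆ v ∧ (h ∈ G.flags ∨ ∃ e ∈ B, h ⊆ e)).card

/-- `φ_S` : the permutation agreeing with `f` on `S` and the identity off `S`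
(defined whenever `S` is `f`-invariant, and the identity otherwise). -/
def permRestrict (f : Equiv.Perm X) (S : Finset X) : Equiv.Perm X :=
  if h : ∀ x : X, x ∈ S ↔ f x ∈ S then Equiv.Perm.ofSubtype (f.subtypePerm fun x => (h x).symm) else 1

/-- The set of crosses of a set of edges. -/
def crossSet (E' : Finset (Finset X)) : Finset X := E'.biUnion id

/-- Chmutov's partial dual `G^{E'}`. -/
def partialDual (G : RawRibbon X) (E' : Finset (Finset X)) : RawRibbon X where
  s0 := G.s0 * permRestrict G.th (crossSet E') * permRestrict G.s1 (crossSet E')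
  th := permRestrict G.s1 (crossSet E') * permRestrict G.th (crossSet E')ᶜ
  s1 := permRestrict G.s1 (crossSet E')ᶜ * permRestrict G.th (crossSet E')

/-- The topological polynomial `Q` of a ribbon graph with flags. -/
def Qpoly {R : Type} [CommRing R] (G : RawRibbon X) (x y z w : Finset X → R) (r : ℕ → R) : R :=
  ∑ A ∈ G.edges.powerset, ∑ B ∈ (G.partialDual A).edges.powerset,
    (∏ e ∈ (G.edges \ A) ∩ ((G.partialDual A).edges \ B), x e) *
      (∏ e ∈ A ∩ ((G.partialDual A).edges \ B), y e) *
      (∏ e ∈ A ∩ B, z e) *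
      (∏ e ∈ (G.edges \ A) ∩ B, w e) *
      ∏ v ∈ (G.partialDual A).vertices, r (degB (G.partialDual A) B v)

/-- The first hyperbolic polynomial `HU` as an evaluation of `Q`. -/
noncomputable def HU (G : RawRibbon X) (Ω t : Finset X → ℝ) : ℝ :=
  Qpoly G t Ω (fun e => Ω e * t e ^ 2) (fun e => t e * Ω e ^ 2)
    fun n => if Even n then 0 else 2

end RawRibbon

end RibbonPaper

theorem test : True := trivial
namespace RibbonPaper

namespace RawRibbon

variable {X : Type} [Fintype X] [DecidableEq X]

lemma firstRet_exists (f : Equiv.Perm X) (S : Finset X) {x : X} (hx : x ∈ S) :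
    ∃ k : ℕ, 0 < k ∧ (f ^ k) x ∈ S :=
  ⟨orderOf f, orderOf_pos f, by rw [pow_orderOf_eq_one]; simpa using hx⟩

open scoped Classical in
/-- The first-return map of a permutation on a subset. -/
noncomputable def firstRet (f : Equiv.Perm X) (S : Finset X) (x : X) : X :=
  if h : ∃ k : ℕ, 0 < k ∧ (f ^ k) x ∈ S then (f ^ Nat.find h) x else x

lemma firstRet_mem (f : Equiv.Perm X) (S : Finset X) {x : X} (hx : x ∈ S) :
    firstRet f S x ∈ S := by
  rw [firstRet, dif_pos (firstRet_exists f S hx)]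
  exact (Nat.find_spec (firstRet_exists f S hx)).2

lemma firstRet_inj_aux (f : Equiv.Perm X) (S : Finset X) {x y : X}
    (hx : x ∈ S) (hy : y ∈ S)
    (hle : Nat.find (firstRet_exists f S hx) ≤ Nat.find (firstRet_exists f S hy))
    (h : firstRet f S x = firstRet f S y) : x = y := by
  have hex := firstRet_exists f S hx
  have hey := firstRet_exists f S hy
  rw [firstRet, dif_pos hex, firstRet, dif_pos hey] at h
  have hxy : x = (f ^ (Nat.find hey - Nat.find hex)) y := by
    apply Equiv.injective (f ^ Nat.find hex)
    rw [← Equiv.Perm.mul_apply, ← pow_add, Nat.add_sub_cancel' hle]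
    exact h
  by_cases h0 : Nat.find hey - Nat.find hex = 0
  · rw [h0, pow_zero] at hxy
    simpa using hxy
  · exfalso
    have hlt : Nat.find hey - Nat.find hex < Nat.find hey :=
      Nat.sub_lt (Nat.find_spec hey).1 (Nat.find_spec hex).1
    apply Nat.find_min hey hlt
    refine ⟨Nat.pos_of_ne_zero h0, ?_⟩
    rw [hxy] at hx
    exact hx

lemma firstRet_inj (f : Equiv.Perm X) (S : Finset X) {x y : X}
    (hx : x ∈ S) (hy : y ∈ S) (h : firstRet f S x = firstRet f S y) : x = y := by
  rcases le_total (Nat.find (firstRet_exists f S hx)) (Nat.find (firstRet_exists f S hy)) with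
    hle | hle
  · exact firstRet_inj_aux f S hx hy hle h
  · exact (firstRet_inj_aux f S hy hx hle h.symm).symm

/-- The permutation induced on a subset `S` by a permutation of `X`
(the first-return map). -/
noncomputable def inducedPerm (f : Equiv.Perm X) (S : Finset X) : Equiv.Perm {x : X // x ∈ S} :=
  Equiv.ofBijective (fun a => ⟨firstRet f S a.1, firstRet_mem f S a.2⟩)
    (Finite.injective_iff_bijective.mp fun a b hab =>
      Subtype.ext (firstRet_inj f S a.2 b.2 (congrArg Subtype.val hab)))

/-- The ribbon graph obtained by restricting to a subset `S` of the crosses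
(deleting all crosses outside `S`). -/
noncomputable def restrict (G : RawRibbon X) (S : Finset X) : RawRibbon {x : X // x ∈ S} :=
  ⟨inducedPerm G.s0 S, inducedPerm G.th S, inducedPerm G.s1 S⟩

/-- Deletion of an edge `e` (given by its finset of crosses). -/
noncomputable def delete (G : RawRibbon X) (e : Finset X) : RawRibbon {x : X // x ∈ eᶜ} :=
  G.restrict eᶜ

/-- The cut of an edge `e`: `σ₁` is replaced by `(σ₁)_{X∖e}`, so the two
half-edges of `e` become flags. -/
def cut (G : RawRibbon X) (e : Finset X) : RawRibbon X :=
  ⟨G.s0, G.th, permRestrict G.s1 eᶜ⟩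

/-- Connectivity: the crosses form a single orbit under the group generated by the
three permutations. -/
def Connected (G : RawRibbon X) : Prop :=
  ∀ x y : X, ∃ g ∈ Subgroup.closure ({G.s0, G.th, G.s1} : Set (Equiv.Perm X)), g x = y

/-- Two vertices are linked by an edge of `A` if `e ∈ A` has a half-edge incident to each. -/
def linked (G : RawRibbon X) (A : Finset (Finset X)) (u v : Finset X) : Prop :=
  ∃ e ∈ A, (∃ h ∈ G.halfRibbons, h ⊆ e ∧ h ⊆ u) ∧ ∃ h ∈ G.halfRibbons, h ⊆ e ∧ h ⊆ v

/-- Connectivity of two vertices in the spanning subgraph `(V(G), A)`. -/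
def vconn (G : RawRibbon X) (A : Finset (Finset X)) : Finset X → Finset X → Prop :=
  Relation.ReflTransGen (G.linked A)

/-- The spanning subgraph `(V(G), A)` is connected. -/
def SpanningConn (G : RawRibbon X) (A : Finset (Finset X)) : Prop :=
  ∀ u ∈ G.vertices, ∀ v ∈ G.vertices, G.vconn A u v

/-- The number of faces (boundary components) of a ribbon graph: the number of
vertices of its natural dual. -/
def nFaces (G : RawRibbon X) : ℕ := (G.partialDual G.edges).vertices.card

/-- The number of boundary components of the spanning subgraph of `G` with surviving
crosses `S`, counting also the vertices of `G` that have become isolated. -/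
noncomputable def nBoundary (G : RawRibbon X) (S : Finset X) : ℕ :=
  (G.restrict S).nFaces + (G.vertices.filter fun v => Disjoint v S).card

/-- A spanning quasi-tree: the spanning subgraph `(V(G), A)` is connected and has
exactly one face. -/
def IsQuasiTree (G : RawRibbon X) (A : Finset (Finset X)) : Prop :=
  G.SpanningConn A ∧ G.nBoundary (crossSet A) = 1

/-- A spanning tree: the spanning subgraph `(V(G), A)` is connected and
`|A| = v(G) - 1`. -/
def IsSpanningTree (G : RawRibbon X) (A : Finset (Finset X)) : Prop :=
  G.SpanningConn A ∧ A.card + 1 = G.vertices.card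

open scoped Classical in
/-- The first Symanzik polynomial of the noncommutative heat-kernel theory. -/
noncomputable def Upoly (G : RawRibbon X) (α : Finset X → ℝ) (θ : ℝ) : ℝ :=
  ∑ A ∈ G.edges.powerset.filter (fun A => G.IsQuasiTree A),
    (θ / 2) ^ (A.card + 1 - G.vertices.card) * ∏ e ∈ G.edges \ A, α e

end RawRibbon

end RibbonPaper
namespace RibbonPaper

namespace RawRibbon

variable {X : Type} [Fintype X] [DecidableEq X]

/-- Even spanning subgraphs of `G`. -/
def evenSubs (G : RawRibbon X) : Finset (Finset (Finset X)) :=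
  G.edges.powerset.filter fun B => ∀ v ∈ G.vertices, Even (G.degB B v)

/-- Odd spanning subgraphs of `G`. -/
def oddSubs (G : RawRibbon X) : Finset (Finset (Finset X)) :=
  G.edges.powerset.filter fun B => ∀ v ∈ G.vertices, Odd (G.degB B v)

/-- Odd cutting spanning subgraphs of `G`: subsets of half-ribbons such that every
vertex is incident to an odd number of them. -/
def oddCutting (G : RawRibbon X) : Finset (Finset (Finset X)) :=
  G.halfRibbons.powerset.filter fun H =>
    ∀ v ∈ G.vertices, Odd ((H.filter fun h => h ⊆ v).card)

/-- Even cutting spanning subgraphs of `G`. -/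
def evenCutting (G : RawRibbon X) : Finset (Finset (Finset X)) :=
  G.halfRibbons.powerset.filter fun H =>
    ∀ v ∈ G.vertices, Even ((H.filter fun h => h ⊆ v).card)

/-- The flag-set of a cutting spanning subgraph `H`: the flags of `G` contained in `H`
together with the edges exactly one of whose two half-edges lies in `H`. -/
def flagSetOf (G : RawRibbon X) (H : Finset (Finset X)) : Finset (Finset X) :=
  (G.flags ∩ H) ∪ (G.edges.filter fun e => (H.filter fun h => h ⊆ e).card = 1)

/-- Orientability of a ribbon graph with flags. -/
def Orientable (G : RawRibbon X) : Prop :=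
  ∃ Xp : Finset X,
    Xp.image G.s0 = Xp ∧ Disjoint Xp (Xp.image G.th) ∧
      Xp ∪ Xp.image G.th = Finset.univ ∧
      ∀ x : X, G.s1 x ≠ x → (x ∈ Xp ↔ G.s1 x ∉ Xp)

/-- The edge variable of the edge of `G` containing the half-ribbon `h`
(as a product over the containing edges; a flag contributes `1`). -/
def halfWeight {R : Type} [CommRing R] (G : RawRibbon X) (t : Finset X → R)
    (h : Finset X) : R :=
  ∏ e ∈ G.edges.filter (fun e => h ⊆ e), t e

/-- The vertex containing a given half-ribbon. -/
def vertexOfHalf (G : RawRibbon X) (h : Finset X) : Finset X :=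
  (G.vertices.filter fun v => h ⊆ v).sup id

/-- The spin product `σ_u σ_{u'}` over the endpoints of an edge `e`, for the spin
configuration assigning `+1` to vertices in `T` and `-1` to the others. -/
noncomputable def spinProd (G : RawRibbon X) (T : Finset (Finset X)) (e : Finset X) : ℝ :=
  ∏ h ∈ G.halfRibbons.filter (fun h => h ⊆ e),
    (if G.vertexOfHalf h ∈ T then (1 : ℝ) else -1)

/-- An isolated vertex of even degree: incident to no half-edge and to an even
number of flags. -/
def IsIsolatedEvenVertex (G : RawRibbon X) (v : Finset X) : Prop :=
  v ∈ G.vertices ∧ (∀ h ∈ G.halfRibbons, h ⊆ v → h ∈ G.flags) ∧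
    Even ((G.flags.filter fun h => h ⊆ v).card)

open scoped Classical in
/-- The number of endpoints of edges of `B` lying in the `A`-connected component of the
vertex `v`, plus the number of flags attached to vertices of that component. -/
noncomputable def compDeg (G : RawRibbon X) (A B : Finset (Finset X)) (v : Finset X) : ℕ :=
  (G.halfRibbons.filter fun h =>
      (h ∈ G.flags ∨ ∃ e ∈ B, h ⊆ e) ∧ ∃ u ∈ G.vertices, G.vconn A v u ∧ h ⊆ u).card

/-- `(B, V(G/A))` is odd: every connected component of the spanning subgraph
`(V(G), A)` sees an odd number of endpoints of edges of `B` plus flags. -/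
def CompOdd (G : RawRibbon X) (A B : Finset (Finset X)) : Prop :=
  ∀ v ∈ G.vertices, Odd (compDeg G A B v)

open scoped Classical in
/-- The connected component of the vertex `v` in the spanning subgraph `(V(G), A)`. -/
noncomputable def compVerts (G : RawRibbon X) (A : Finset (Finset X)) (v : Finset X) :
    Finset (Finset X) :=
  G.vertices.filter fun u => G.vconn A v u

/-- The connected components of the spanning subgraph `(V(G), A)`. -/
noncomputable def components (G : RawRibbon X) (A : Finset (Finset X)) :
    Finset (Finset (Finset X)) :=
  G.vertices.image fun v => compVerts G A v

/-- The edges of `A` incident to a set of vertices `c`. -/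
def compEdges (G : RawRibbon X) (A : Finset (Finset X)) (c : Finset (Finset X)) :
    Finset (Finset X) :=
  A.filter fun e => ∃ h ∈ G.halfRibbons, h ⊆ e ∧ ∃ u ∈ c, h ⊆ u

open scoped Classical in
/-- The cycle edges of a (unicyclic) component `c`: those edges whose removal keeps
the component connected. -/
noncomputable def cycleEdges (G : RawRibbon X) (A : Finset (Finset X))
    (c : Finset (Finset X)) : Finset (Finset X) :=
  (compEdges G A c).filter fun e => ∀ u ∈ c, ∀ u' ∈ c, G.vconn (A.erase e) u u'

/-- The weight of a connected component in the commutative Mehler-kernel limit. -/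
noncomputable def compWeight (G : RawRibbon X) (A : Finset (Finset X)) (Ω t : Finset X → ℝ)
    (c : Finset (Finset X)) : ℝ :=
  if (compEdges G A c).card + 1 = c.card then
    (2 : ℝ) ^ (1 - ((compEdges G A c).card : ℤ)) *
      ∑ e ∈ compEdges G A c,
        Ω e ^ 2 * t e * ∏ e' ∈ (compEdges G A c).erase e, Ω e' * (1 + t e' ^ 2)
  else
    (2 : ℝ) ^ (2 - ((compEdges G A c).card : ℤ)) *
      ∑ C' ∈ (cycleEdges G A c).powerset.filter (fun C' => Odd C'.card),
        (∏ e ∈ C', Ω e * t e ^ 2) *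
          ∏ e' ∈ compEdges G A c \ cycleEdges G A c, Ω e' * (1 + t e' ^ 2)

/-- The graph `Ĝ_{i₀}` : the half-edge `i₀` (with crosses `x₀, θ x₀`) is detached from
its vertex, replaced there by a flag (crosses `inr 0, inr 1`), and attached to a new
bivalent vertex carrying one more flag (crosses `inr 2, inr 3`). -/
def hatGraph (G : RawRibbon X) (x₀ : X) : RawRibbon (X ⊕ Fin 4) where
  s0 :=
    (Equiv.swap (Sum.inl x₀) (Sum.inr 0) * Equiv.swap (Sum.inl (G.th x₀)) (Sum.inr 1)) *
        Equiv.sumCongr G.s0 (Equiv.refl (Fin 4)) *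
        (Equiv.swap (Sum.inl x₀) (Sum.inr 0) * Equiv.swap (Sum.inl (G.th x₀)) (Sum.inr 1))⁻¹ *
      Equiv.swap (Sum.inl x₀) (Sum.inr 2) * Equiv.swap (Sum.inl (G.th x₀)) (Sum.inr 3)
  th := Equiv.sumCongr G.th (Equiv.swap 0 1 * Equiv.swap 2 3)
  s1 := Equiv.sumCongr G.s1 (Equiv.refl (Fin 4))

end RawRibbon

end RibbonPaper
namespace RibbonPaper

namespace RawRibbon

section Helpers

variable {X : Type} [Fintype X] [DecidableEq X]

/-- The axioms on `θ` and `σ₁` only. -/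
structure EdgeAx (G : RawRibbon X) : Prop where
  tt : ∀ x, G.th (G.th x) = x
  ss : ∀ x, G.s1 (G.s1 x) = x
  ts : ∀ x, G.th (G.s1 x) = G.s1 (G.th x)
  tne : ∀ x, G.th x ≠ x
  sne : ∀ x, G.s1 x ≠ x
  tsne : ∀ x, G.th x ≠ G.s1 x

/-- The weak axioms of a ribbon graph without flags. -/
structure WeakAx (G : RawRibbon X) : Prop extends EdgeAx G where
  st : ∀ x, G.s0 (G.th (G.s0 x)) = G.th x

lemma weakAx_of (G : RawRibbon X) (hG : G.IsRibbon) (hnf : G.NoFlags) : WeakAx G := by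
  obtain ⟨h1, h2, h3, h4, h5, h6, -⟩ := hG
  refine ⟨⟨fun x => ?_, fun x => ?_, fun x => ?_, h4, hnf, h5⟩, fun x => ?_⟩
  · simpa [sq] using congrArg (fun f : Equiv.Perm X => f x) h1
  · simpa [sq] using congrArg (fun f : Equiv.Perm X => f x) h2
  · simpa using congrArg (fun f : Equiv.Perm X => f x) h3
  · simpa using congrArg (fun f : Equiv.Perm X => f (G.s0 x)) h6

/-- The edge through a cross. -/
def edgeOf (G : RawRibbon X) (x : X) : Finset X := {x, G.th x, G.s1 x, G.s1 (G.th x)}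

lemma edgeOf_th {G : RawRibbon X} (hG : EdgeAx G) (x : X) : G.edgeOf (G.th x) = G.edgeOf x := by
  ext y
  simp only [edgeOf, mem_insert, mem_singleton, hG.tt]
  tauto

lemma edgeOf_s1 {G : RawRibbon X} (hG : EdgeAx G) (x : X) : G.edgeOf (G.s1 x) = G.edgeOf x := by
  ext y
  simp only [edgeOf, mem_insert, mem_singleton, hG.ss, hG.ts]
  tauto

lemma mem_edgeOf_self (G : RawRibbon X) (x : X) : x ∈ G.edgeOf x := by simp [edgeOf]

lemma edgeOf_eq {G : RawRibbon X} (hG : EdgeAx G) {x y : X} (h : x ∈ G.edgeOf y) :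
    G.edgeOf x = G.edgeOf y := by
  simp only [edgeOf, mem_insert, mem_singleton] at h
  rcases h with rfl | rfl | rfl | rfl
  · rfl
  · exact edgeOf_th hG _
  · exact edgeOf_s1 hG _
  · rw [edgeOf_s1 hG, edgeOf_th hG]

lemma mem_edges {G : RawRibbon X} (hG : EdgeAx G) (e : Finset X) :
    e ∈ G.edges ↔ ∃ x, G.edgeOf x = e := by
  simp [edges, edgeOf, hG.sne]

lemma mem_crossSet {G : RawRibbon X} (hG : EdgeAx G) {A : Finset (Finset X)}
    (hA : A ⊆ G.edges) (x : X) : x ∈ crossSet A ↔ G.edgeOf x ∈ A := by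
  simp only [crossSet, mem_biUnion, id]
  constructor
  · rintro ⟨e, he, hx⟩
    obtain ⟨y, rfl⟩ := (mem_edges hG e).1 (hA he)
    rwa [edgeOf_eq hG hx]
  · intro h
    exact ⟨_, h, G.mem_edgeOf_self x⟩

lemma th_mem {G : RawRibbon X} (hG : EdgeAx G) {A : Finset (Finset X)}
    (hA : A ⊆ G.edges) (x : X) : G.th x ∈ crossSet A ↔ x ∈ crossSet A := by
  rw [mem_crossSet hG hA, mem_crossSet hG hA, edgeOf_th hG]

lemma s1_mem {G : RawRibbon X} (hG : EdgeAx G) {A : Finset (Finset X)}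
    (hA : A ⊆ G.edges) (x : X) : G.s1 x ∈ crossSet A ↔ x ∈ crossSet A := by
  rw [mem_crossSet hG hA, mem_crossSet hG hA, edgeOf_s1 hG]

lemma permRestrict_apply (f : Equiv.Perm X) (S : Finset X) (h : ∀ x, f x ∈ S ↔ x ∈ S) (x : X) :
    permRestrict f S x = if x ∈ S then f x else x := by
  rw [permRestrict, dif_pos (fun x => (h x).symm)]
  split_ifs with hx
  · rw [Equiv.Perm.ofSubtype_apply_of_mem _ hx]
    rfl
  · exact Equiv.Perm.ofSubtype_apply_of_not_mem _ hx

lemma pd_th {G : RawRibbon X} (hG : EdgeAx G) {A : Finset (Finset X)}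
    (hA : A ⊆ G.edges) (x : X) :
    (G.partialDual A).th x = if x ∈ crossSet A then G.s1 x else G.th x := by
  have h1 := permRestrict_apply G.s1 (crossSet A) (s1_mem hG hA)
  have h2 := permRestrict_apply G.th (crossSet A)ᶜ (fun x => by simp [th_mem hG hA])
  simp only [partialDual, Equiv.Perm.mul_apply, h1, h2, mem_compl]
  split_ifs <;> simp_all [th_mem hG hA]

lemma pd_s1 {G : RawRibbon X} (hG : EdgeAx G) {A : Finset (Finset X)}
    (hA : A ⊆ G.edges) (x : X) :
    (G.partialDual A).s1 x = if x ∈ crossSet A then G.th x else G.s1 x := by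
  have h1 := permRestrict_apply G.th (crossSet A) (th_mem hG hA)
  have h2 := permRestrict_apply G.s1 (crossSet A)ᶜ (fun x => by simp [s1_mem hG hA])
  simp only [partialDual, Equiv.Perm.mul_apply, h1, h2, mem_compl]
  by_cases hx : x ∈ crossSet A <;> simp [hx, th_mem hG hA]

lemma pd_s0 {G : RawRibbon X} (hG : EdgeAx G) {A : Finset (Finset X)}
    (hA : A ⊆ G.edges) (x : X) :
    (G.partialDual A).s0 x = if x ∈ crossSet A then G.s0 (G.th (G.s1 x)) else G.s0 x := by
  have h1 := permRestrict_apply G.th (crossSet A) (th_mem hG hA)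
  have h2 := permRestrict_apply G.s1 (crossSet A) (s1_mem hG hA)
  simp only [partialDual, Equiv.Perm.mul_apply, h1, h2]
  by_cases hx : x ∈ crossSet A <;> simp [hx, s1_mem hG hA]

lemma pd_edgeAx {G : RawRibbon X} (hG : EdgeAx G) {A : Finset (Finset X)}
    (hA : A ⊆ G.edges) : EdgeAx (G.partialDual A) := by
  have ht := pd_th hG hA
  have hs := pd_s1 hG hA
  have m1 := th_mem hG hA
  have m2 := s1_mem hG hA
  refine ⟨?_, ?_, ?_, ?_, ?_, ?_⟩ <;> intro x <;> by_cases hx : x ∈ crossSet A <;>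
    simp [ht, hs, m1, m2, hx, hG.tt, hG.ss, hG.ts, hG.tne, hG.sne, hG.tsne, (hG.tsne _).symm]

lemma pd_weakAx {G : RawRibbon X} (hG : WeakAx G) {A : Finset (Finset X)}
    (hA : A ⊆ G.edges) : WeakAx (G.partialDual A) := by
  refine ⟨pd_edgeAx hG.toEdgeAx hA, fun x => ?_⟩
  have ht := pd_th hG.toEdgeAx hA
  have h0 := pd_s0 hG.toEdgeAx hA
  have m1 := th_mem hG.toEdgeAx hA
  have m2 := s1_mem hG.toEdgeAx hA
  have st := hG.st
  have key : ∀ y, (G.partialDual A).s0 ((G.partialDual A).th (G.s0 y)) = G.th y := by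
    intro y
    rw [ht]
    by_cases hy : G.s0 y ∈ crossSet A
    · simp [h0, hy, m2, hG.ss, st]
    · simp [h0, hy, m1, st]
  rw [h0 x]
  split_ifs with hx
  · rw [key, hG.tt, ht, if_pos hx]
  · rw [key, ht, if_neg hx]

lemma pd_edgeOf {G : RawRibbon X} (hG : EdgeAx G) {A : Finset (Finset X)}
    (hA : A ⊆ G.edges) (x : X) : (G.partialDual A).edgeOf x = G.edgeOf x := by
  have ht := pd_th hG hA
  have hs := pd_s1 hG hA
  have m1 := th_mem hG hA
  have m2 := s1_mem hG hA
  ext y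
  by_cases hx : x ∈ crossSet A
  · simp only [edgeOf, ht, hs, hx, m2, if_true, mem_insert, mem_singleton, hG.ts]
    tauto
  · simp only [edgeOf, ht, hs, hx, m1, if_false, mem_insert, mem_singleton]

lemma pd_edges {G : RawRibbon X} (hG : EdgeAx G) {A : Finset (Finset X)}
    (hA : A ⊆ G.edges) : (G.partialDual A).edges = G.edges := by
  ext e
  rw [mem_edges hG, mem_edges (pd_edgeAx hG hA)]
  simp only [pd_edgeOf hG hA]

lemma ext_raw {G H : RawRibbon X} (h0 : ∀ x, G.s0 x = H.s0 x) (h1 : ∀ x, G.th x = H.th x)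
    (h2 : ∀ x, G.s1 x = H.s1 x) : G = H := by
  cases G; cases H
  simp only [mk.injEq]
  exact ⟨Equiv.ext h0, Equiv.ext h1, Equiv.ext h2⟩

lemma pd_pd {G : RawRibbon X} (hG : EdgeAx G) {A B : Finset (Finset X)}
    (hA : A ⊆ G.edges) (hB : B ⊆ G.edges) :
    (G.partialDual A).partialDual B = G.partialDual (symmDiff A B) := by
  have hC : symmDiff A B ⊆ G.edges := by
    intro e he
    rcases mem_symmDiff.1 he with h | h
    · exact hA h.1
    · exact hB h.1
  have hB' : B ⊆ (G.partialDual A).edges := by rwa [pd_edges hG hA]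
  have hG' := pd_edgeAx hG hA
  have mC : ∀ x, x ∈ crossSet (symmDiff A B) ↔
      ((x ∈ crossSet A ∧ x ∉ crossSet B) ∨ (x ∈ crossSet B ∧ x ∉ crossSet A)) := by
    intro x
    rw [mem_crossSet hG hC, mem_crossSet hG hA, mem_crossSet hG hB, mem_symmDiff]
  have a1 := th_mem hG hA
  have a2 := s1_mem hG hA
  apply ext_raw <;> intro x
  · rw [pd_s0 hG' hB', pd_s0 hG hC]
    by_cases h1 : x ∈ crossSet A <;> by_cases h2 : x ∈ crossSet B <;>
      simp [mC, h1, h2, pd_s0 hG hA, pd_th hG hA, pd_s1 hG hA, a1, a2, hG.ss, hG.tt, hG.ts]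
  · rw [pd_th hG' hB', pd_th hG hC]
    by_cases h1 : x ∈ crossSet A <;> by_cases h2 : x ∈ crossSet B <;>
      simp [mC, h1, h2, pd_th hG hA, pd_s1 hG hA]
  · rw [pd_s1 hG' hB', pd_s1 hG hC]
    by_cases h1 : x ∈ crossSet A <;> by_cases h2 : x ∈ crossSet B <;>
      simp [mC, h1, h2, pd_th hG hA, pd_s1 hG hA]

/-! ### Vertices -/

lemma mem_permOrbit (f : Equiv.Perm X) (x y : X) : y ∈ permOrbit f x ↔ f.SameCycle x y := by
  simp only [permOrbit, mem_image, mem_range]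
  constructor
  · rintro ⟨n, -, h⟩
    exact ⟨n, by simpa using h⟩
  · intro h
    obtain ⟨n, hn⟩ := h.exists_nat_pow_eq
    have hp : 0 < Function.minimalPeriod f x :=
      Function.minimalPeriod_pos_of_mem_periodicPts (by
        refine ⟨orderOf f, orderOf_pos f, ?_⟩
        rw [Function.IsPeriodicPt, Equiv.Perm.iterate_eq_pow, pow_orderOf_eq_one]
        rfl)
    refine ⟨n % Function.minimalPeriod f x, ?_, ?_⟩
    · refine (Nat.mod_lt _ hp).trans_le ?_
      have := Finset.card_le_univ ((range (Function.minimalPeriod f x)).image fun n => f^[n] x)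
      rwa [card_image_of_injOn, card_range] at this
      intro a ha b hb hab
      exact Function.iterate_injOn_Iio_minimalPeriod (by simpa using ha) (by simpa using hb) hab
    · rw [← hn, ← Equiv.Perm.iterate_eq_pow, ← Equiv.Perm.iterate_eq_pow]
      exact Function.iterate_mod_minimalPeriod_eq

lemma mem_vertexOf (G : RawRibbon X) (x y : X) :
    y ∈ G.vertexOf x ↔ G.s0.SameCycle x y ∨ G.s0.SameCycle (G.th x) y := by
  simp only [vertexOf, mem_union, mem_permOrbit]

lemma sameCycle_th {G : RawRibbon X} (hG : WeakAx G) {x y : X} (h : G.s0.SameCycle x y) :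
    G.s0.SameCycle (G.th x) (G.th y) := by
  obtain ⟨n, rfl⟩ := h.exists_nat_pow_eq
  clear h
  induction n with
  | zero => exact Equiv.Perm.SameCycle.refl _ _
  | succ n ih =>
    refine ih.trans ?_
    rw [pow_succ', Equiv.Perm.mul_apply, ← hG.st ((G.s0 ^ n) x)]
    exact (Equiv.Perm.sameCycle_apply_left.2 (Equiv.Perm.SameCycle.refl _ _))

lemma self_mem_vertexOf (G : RawRibbon X) (x : X) : x ∈ G.vertexOf x :=
  (G.mem_vertexOf x x).2 (Or.inl (Equiv.Perm.SameCycle.refl _ _))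

lemma th_mem_vertexOf (G : RawRibbon X) (x : X) : G.th x ∈ G.vertexOf x :=
  (G.mem_vertexOf x _).2 (Or.inr (Equiv.Perm.SameCycle.refl _ _))

lemma s0_mem_vertexOf (G : RawRibbon X) (x : X) : G.s0 x ∈ G.vertexOf x :=
  (G.mem_vertexOf x _).2 (Or.inl (Equiv.Perm.sameCycle_apply_right.2
    (Equiv.Perm.SameCycle.refl _ _)))

lemma vertexOf_eq {G : RawRibbon X} (hG : WeakAx G) {x y : X} (h : y ∈ G.vertexOf x) :
    G.vertexOf y = G.vertexOf x := by
  ext z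
  rw [mem_vertexOf] at h
  simp only [mem_vertexOf]
  rcases h with h | h
  · have h' := sameCycle_th hG h
    exact or_congr ⟨h.trans, h.symm.trans⟩ ⟨h'.trans, h'.symm.trans⟩
  · have h' := sameCycle_th hG h
    rw [hG.tt] at h'
    rw [or_comm]
    exact or_congr ⟨h'.trans, h'.symm.trans⟩ ⟨h.trans, h.symm.trans⟩

lemma mem_vertices (G : RawRibbon X) (v : Finset X) : v ∈ G.vertices ↔ ∃ x, G.vertexOf x = v := by
  simp [vertices]

lemma eq_of_mem_vertex {G : RawRibbon X} (hG : WeakAx G) {v : Finset X} (hv : v ∈ G.vertices)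
    {x : X} (hx : x ∈ v) : v = G.vertexOf x := by
  obtain ⟨y, rfl⟩ := (G.mem_vertices v).1 hv
  exact (vertexOf_eq hG hx).symm

/-! ### First return maps -/

lemma firstRet_eq (f : Equiv.Perm X) (S : Finset X) (x : X) (k : ℕ) (hk : 0 < k)
    (hm : (f ^ k) x ∈ S) (hn : ∀ j, 0 < j → j < k → (f ^ j) x ∉ S) :
    firstRet f S x = (f ^ k) x := by
  classical
  have hex : ∃ k : ℕ, 0 < k ∧ (f ^ k) x ∈ S := ⟨k, hk, hm⟩
  rw [firstRet, dif_pos hex]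
  have : Nat.find hex = k := by
    rw [Nat.find_eq_iff]
    exact ⟨⟨hk, hm⟩, fun j hj h => hn j h.1 hj h.2⟩
  rw [this]

lemma firstRet_spec (f : Equiv.Perm X) (S : Finset X) {x : X} (hx : x ∈ S) :
    ∃ k, 0 < k ∧ firstRet f S x = (f ^ k) x ∧ (f ^ k) x ∈ S ∧
      ∀ j, 0 < j → j < k → (f ^ j) x ∉ S := by
  classical
  have hex := firstRet_exists f S hx
  refine ⟨Nat.find hex, (Nat.find_spec hex).1, ?_, (Nat.find_spec hex).2, ?_⟩
  · rw [firstRet, dif_pos hex]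
  · intro j hj hlt h
    exact Nat.find_min hex hlt ⟨hj, h⟩

lemma inducedPerm_val (f : Equiv.Perm X) (S : Finset X) (a : {x : X // x ∈ S}) :
    (inducedPerm f S a).1 = firstRet f S a.1 := rfl

lemma inducedPerm_inv (f : Equiv.Perm X) (S : Finset X) (h : ∀ x, f x ∈ S ↔ x ∈ S)
    (a : {x : X // x ∈ S}) : (inducedPerm f S a).1 = f a.1 := by
  rw [inducedPerm_val, firstRet_eq f S a.1 1 one_pos (by simpa using (h _).2 a.2) (by omega)]
  simp

lemma inducedPerm_sameCycle (f : Equiv.Perm X) (S : Finset X) (a b : {x : X // x ∈ S}) :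
    (inducedPerm f S).SameCycle a b ↔ f.SameCycle a.1 b.1 := by
  constructor
  · intro h
    obtain ⟨n, rfl⟩ := h.exists_nat_pow_eq
    clear h
    induction n with
    | zero => exact Equiv.Perm.SameCycle.refl _ _
    | succ n ih =>
      refine ih.trans ?_
      rw [pow_succ', Equiv.Perm.mul_apply, inducedPerm_val]
      obtain ⟨k, -, hk, -⟩ := firstRet_spec f S ((inducedPerm f S ^ n) a).2
      rw [hk]
      exact ⟨k, by simp⟩
  · intro h
    obtain ⟨n, hn⟩ := h.exists_nat_pow_eq
    clear h
    induction n using Nat.strong_induction_on generalizing a with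
    | _ n ih =>
      rcases Nat.eq_zero_or_pos n with rfl | hpos
      · have : a = b := Subtype.ext (by simpa using hn)
        rw [this]
      · obtain ⟨k, hk0, hk, hkm, hkn⟩ := firstRet_spec f S a.2
        have hle : k ≤ n := by
          by_contra hlt
          exact hkn n hpos (by omega) (by rw [hn]; exact b.2)
        have := ih (n - k) (by omega) (inducedPerm f S a) (by
          rw [inducedPerm_val, hk, ← Equiv.Perm.mul_apply, ← pow_add, Nat.sub_add_cancel hle, hn])
        exact Equiv.Perm.sameCycle_apply_left.1 this

/-! ### Boundary components of spanning subgraphs -/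

section Boundary

variable {G : RawRibbon X} {B : Finset (Finset X)}

lemma restrict_th (hG : EdgeAx G) (hB : B ⊆ G.edges) (a : {x : X // x ∈ crossSet B}) :
    ((G.restrict (crossSet B)).th a).1 = G.th a.1 :=
  inducedPerm_inv _ _ (th_mem hG hB) a

lemma restrict_s1 (hG : EdgeAx G) (hB : B ⊆ G.edges) (a : {x : X // x ∈ crossSet B}) :
    ((G.restrict (crossSet B)).s1 a).1 = G.s1 a.1 :=
  inducedPerm_inv _ _ (s1_mem hG hB) a

lemma restrict_edgeAx (hG : EdgeAx G) (hB : B ⊆ G.edges) :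
    EdgeAx (G.restrict (crossSet B)) := by
  have ht := restrict_th hG hB
  have hs := restrict_s1 hG hB
  refine ⟨?_, ?_, ?_, ?_, ?_, ?_⟩ <;> intro a
  · exact Subtype.ext (by rw [ht, ht, hG.tt])
  · exact Subtype.ext (by rw [hs, hs, hG.ss])
  · exact Subtype.ext (by rw [ht, hs, hs, ht, hG.ts])
  · intro h
    exact hG.tne a.1 (by rw [← ht, h])
  · intro h
    exact hG.sne a.1 (by rw [← hs, h])
  · intro h
    exact hG.tsne a.1 (by rw [← hs, ← ht, h])

lemma firstRet_pd (hG : EdgeAx G) (hB : B ⊆ G.edges) {x : X} (hx : x ∈ crossSet B) :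
    firstRet (G.partialDual B).s0 (crossSet B) x =
      firstRet G.s0 (crossSet B) (G.th (G.s1 x)) := by
  have hy : G.th (G.s1 x) ∈ crossSet B := by rwa [th_mem hG hB, s1_mem hG hB]
  obtain ⟨k, hk0, hk, hkm, hkn⟩ := firstRet_spec G.s0 (crossSet B) hy
  have key : ∀ j, j + 1 ≤ k →
      ((G.partialDual B).s0 ^ (j + 1)) x = (G.s0 ^ (j + 1)) (G.th (G.s1 x)) := by
    intro j
    induction j with
    | zero =>
      intro _
      simp [pd_s0 hG hB, hx]
    | succ j ih =>
      intro hj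
      rw [pow_succ', Equiv.Perm.mul_apply, ih (by omega), pd_s0 hG hB,
        if_neg (hkn _ (by omega) (by omega)), ← Equiv.Perm.mul_apply, ← pow_succ']
  have key' : ∀ j, 0 < j → j ≤ k →
      ((G.partialDual B).s0 ^ j) x = (G.s0 ^ j) (G.th (G.s1 x)) := by
    intro j h0 hj
    obtain ⟨i, rfl⟩ : ∃ i, j = i + 1 := ⟨j - 1, by omega⟩
    exact key i hj
  rw [hk, firstRet_eq _ _ _ k hk0, key' k hk0 le_rfl]
  · rw [key' k hk0 le_rfl]; exact hkm
  · intro j h0 hj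
    rw [key' j h0 hj.le]
    exact hkn j h0 hj

lemma dual_restrict_vertexOf (hG : EdgeAx G) (hB : B ⊆ G.edges)
    (a b : {x : X // x ∈ crossSet B}) :
    b ∈ ((G.restrict (crossSet B)).partialDual (G.restrict (crossSet B)).edges).vertexOf a ↔
      b.1 ∈ (G.partialDual B).vertexOf a.1 := by
  have hR := restrict_edgeAx hG hB
  have hall : ∀ a, a ∈ crossSet (G.restrict (crossSet B)).edges := by
    intro a
    rw [mem_crossSet hR subset_rfl, mem_edges hR]
    exact ⟨a, rfl⟩
  have h0 : ((G.restrict (crossSet B)).partialDual (G.restrict (crossSet B)).edges).s0 =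
      inducedPerm (G.partialDual B).s0 (crossSet B) := by
    ext c
    rw [pd_s0 hR subset_rfl, if_pos (hall c), inducedPerm_val, firstRet_pd hG hB c.2,
      ← restrict_s1 hG hB, ← restrict_th hG hB]
    rfl
  have ht : (((G.restrict (crossSet B)).partialDual (G.restrict (crossSet B)).edges).th a).1 =
      (G.partialDual B).th a.1 := by
    rw [pd_th hR subset_rfl, if_pos (hall a), restrict_s1 hG hB, pd_th hG hB, if_pos a.2]
  rw [mem_vertexOf, mem_vertexOf, h0, inducedPerm_sameCycle, inducedPerm_sameCycle, ht]

lemma sameCycle_closed (f : Equiv.Perm X) {P : X → Prop} {x y : X} (h : f.SameCycle x y)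
    (hx : P x) (hP : ∀ z, P z → P (f z)) : P y := by
  obtain ⟨n, rfl⟩ := h.exists_nat_pow_eq
  clear h
  induction n with
  | zero => exact hx
  | succ n ih =>
    rw [pow_succ', Equiv.Perm.mul_apply]
    exact hP _ ih

lemma vertexOf_closed {H : RawRibbon X} {P : X → Prop} {x y : X} (h : y ∈ H.vertexOf x)
    (hx : P x) (h0 : ∀ z, P z → P (H.s0 z)) (ht : ∀ z, P z → P (H.th z)) : P y := by
  rw [mem_vertexOf] at h
  rcases h with h | h
  · exact sameCycle_closed _ h hx h0
  · exact sameCycle_closed _ h (ht _ hx) h0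

/-- If two graphs agree off `S`, then a vertex of the first disjoint from `S` is contained
in the vertex of the second. -/
lemma vertexOf_subset_of_agree {H K : RawRibbon X} (hK : WeakAx K) {S : Finset X}
    (h0 : ∀ x, x ∉ S → H.s0 x = K.s0 x) (ht : ∀ x, x ∉ S → H.th x = K.th x)
    (x : X) (hd : Disjoint (K.vertexOf x) S) :
    H.vertexOf x ⊆ K.vertexOf x := by
  intro y hy
  refine vertexOf_closed (P := fun z => z ∈ K.vertexOf x) hy (K.self_mem_vertexOf x) ?_ ?_
  · intro z hz
    rw [h0 z (Finset.disjoint_left.1 hd hz), ← vertexOf_eq hK hz]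
    exact K.s0_mem_vertexOf z
  · intro z hz
    rw [ht z (Finset.disjoint_left.1 hd hz), ← vertexOf_eq hK hz]
    exact K.th_mem_vertexOf z

lemma vertexOf_eq_of_agree {H K : RawRibbon X} (hH : WeakAx H) (hK : WeakAx K) {S : Finset X}
    (h0 : ∀ x, x ∉ S → H.s0 x = K.s0 x) (ht : ∀ x, x ∉ S → H.th x = K.th x)
    (x : X) (hd : Disjoint (K.vertexOf x) S) :
    H.vertexOf x = K.vertexOf x := by
  have h1 := vertexOf_subset_of_agree hK h0 ht x hd
  refine h1.antisymm ?_
  exact vertexOf_subset_of_agree hH (fun x hx => (h0 x hx).symm) (fun x hx => (ht x hx).symm) x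
    (hd.mono_left h1)

lemma filter_disjoint_eq {H K : RawRibbon X} (hH : WeakAx H) (hK : WeakAx K) {S : Finset X}
    (h0 : ∀ x, x ∉ S → H.s0 x = K.s0 x) (ht : ∀ x, x ∉ S → H.th x = K.th x) :
    (H.vertices.filter fun v => Disjoint v S) = K.vertices.filter fun v => Disjoint v S := by
  ext v
  simp only [mem_filter, mem_vertices]
  constructor
  · rintro ⟨⟨x, rfl⟩, hd⟩
    exact ⟨⟨x, vertexOf_eq_of_agree hK hH (fun x hx => (h0 x hx).symm)
      (fun x hx => (ht x hx).symm) x hd⟩, hd⟩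
  · rintro ⟨⟨x, rfl⟩, hd⟩
    exact ⟨⟨x, vertexOf_eq_of_agree hH hK h0 ht x hd⟩, hd⟩

lemma nBoundary_eq (hG : WeakAx G) (hB : B ⊆ G.edges) :
    G.nBoundary (crossSet B) = (G.partialDual B).vertices.card := by
  have hK := pd_weakAx hG hB
  have hE := hG.toEdgeAx
  have e1 : (G.vertices.filter fun v => Disjoint v (crossSet B)) =
      (G.partialDual B).vertices.filter fun v => Disjoint v (crossSet B) := by
    apply filter_disjoint_eq hG hK
    · intro x hx
      rw [pd_s0 hE hB, if_neg hx]
    · intro x hx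
      rw [pd_th hE hB, if_neg hx]
  have e2 : (G.restrict (crossSet B)).nFaces =
      ((G.partialDual B).vertices.filter fun v => ¬ Disjoint v (crossSet B)).card := by
    rw [nFaces]
    symm
    apply Finset.card_bij (fun v _ => v.subtype (fun x => x ∈ crossSet B))
    · intro v hv
      rw [mem_filter, Finset.not_disjoint_iff] at hv
      obtain ⟨hv, x, hxv, hxS⟩ := hv
      rw [mem_vertices]
      refine ⟨⟨x, hxS⟩, ?_⟩
      ext b
      rw [dual_restrict_vertexOf hE hB, mem_subtype, eq_of_mem_vertex hK hv hxv]
    · intro v hv w hw hvw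
      rw [mem_filter, Finset.not_disjoint_iff] at hv
      obtain ⟨hv, x, hxv, hxS⟩ := hv
      have : (⟨x, hxS⟩ : {x : X // x ∈ crossSet B}) ∈
          w.subtype (fun x => x ∈ crossSet B) := by
        rw [← hvw, mem_subtype]
        exact hxv
      rw [mem_subtype] at this
      rw [eq_of_mem_vertex hK hv hxv, eq_of_mem_vertex hK (mem_filter.1 hw).1 this]
    · intro u hu
      obtain ⟨a, rfl⟩ := (mem_vertices _ u).1 hu
      refine ⟨(G.partialDual B).vertexOf a.1, ?_, ?_⟩
      · rw [mem_filter, Finset.not_disjoint_iff]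
        exact ⟨(mem_vertices _ _).2 ⟨_, rfl⟩, a.1, self_mem_vertexOf _ _, a.2⟩
      · ext b
        rw [dual_restrict_vertexOf hE hB, mem_subtype]
  rw [nBoundary, e1, e2, add_comm]
  exact Finset.card_filter_add_card_filter_not _

lemma one_vertex_rel (hG : WeakAx G) (hB : B ⊆ G.edges)
    (h1 : (G.partialDual B).vertices.card = 1) (R : X → X → Prop)
    (hrefl : ∀ x, R x x) (htrans : ∀ x y z, R x y → R y z → R x z)
    (h0 : ∀ z, R z (G.s0 z)) (ht : ∀ z, R z (G.th z))
    (hs : ∀ z ∈ crossSet B, R z (G.s1 z)) (x y : X) : R x y := by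
  have hE := hG.toEdgeAx
  have hy : y ∈ (G.partialDual B).vertexOf x := by
    obtain ⟨v, hv⟩ := Finset.card_eq_one.1 h1
    have hx : (G.partialDual B).vertexOf x ∈ (G.partialDual B).vertices :=
      (mem_vertices _ _).2 ⟨x, rfl⟩
    have hy : (G.partialDual B).vertexOf y ∈ (G.partialDual B).vertices :=
      (mem_vertices _ _).2 ⟨y, rfl⟩
    rw [hv, mem_singleton] at hx hy
    rw [hx, ← hy]
    exact self_mem_vertexOf _ _
  refine vertexOf_closed (P := fun z => R x z) hy (hrefl x) ?_ ?_
  · intro z hz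
    rw [pd_s0 hE hB]
    split_ifs with hzS
    · exact htrans _ _ _ hz (htrans _ _ _ (hs z hzS) (htrans _ _ _ (ht _) (h0 _)))
    · exact htrans _ _ _ hz (h0 _)
  · intro z hz
    rw [pd_th hE hB]
    split_ifs with hzS
    · exact htrans _ _ _ hz (hs z hzS)
    · exact htrans _ _ _ hz (ht _)

lemma isQuasiTree_iff (hG : WeakAx G) (hB : B ⊆ G.edges) :
    G.IsQuasiTree B ↔ (G.partialDual B).vertices.card = 1 := by
  rw [IsQuasiTree, nBoundary_eq hG hB]
  refine ⟨fun h => h.2, fun h => ⟨?_, h⟩⟩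
  intro u hu v hv
  obtain ⟨x, rfl⟩ := (mem_vertices _ _).1 hu
  obtain ⟨y, rfl⟩ := (mem_vertices _ _).1 hv
  refine one_vertex_rel hG hB h (fun x y => G.vconn B (G.vertexOf x) (G.vertexOf y))
    (fun x => Relation.ReflTransGen.refl) (fun _ _ _ h1 h2 => h1.trans h2) ?_ ?_ ?_ x y
  · intro z
    rw [vertexOf_eq hG (G.s0_mem_vertexOf z)]
    exact Relation.ReflTransGen.refl
  · intro z
    rw [vertexOf_eq hG (G.th_mem_vertexOf z)]
    exact Relation.ReflTransGen.refl
  · intro z hz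
    apply Relation.ReflTransGen.single
    have hh : ∀ w, ({w, G.th w} : Finset X) ∈ G.halfRibbons := fun w => by
      simp only [halfRibbons, mem_image, mem_univ, true_and]
      exact ⟨w, rfl⟩
    have he : ∀ w, ({w, G.th w} : Finset X) ⊆ G.edgeOf w := fun w => by
      intro t
      simp only [edgeOf, mem_insert, mem_singleton]
      tauto
    have hv : ∀ w, ({w, G.th w} : Finset X) ⊆ G.vertexOf w := fun w => by
      intro t
      simp only [mem_insert, mem_singleton]
      rintro (rfl | rfl)
      · exact self_mem_vertexOf _ _
      · exact th_mem_vertexOf _ _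
    refine ⟨G.edgeOf z, (mem_crossSet hG.toEdgeAx hB z).1 hz, ⟨_, hh z, he z, hv z⟩,
      ⟨_, hh (G.s1 z), ?_, hv _⟩⟩
    rw [← edgeOf_s1 hG.toEdgeAx]
    exact he _

lemma card_vertices_le (hG : WeakAx G) (hB : B ⊆ G.edges)
    (h1 : (G.partialDual B).vertices.card = 1) : G.vertices.card ≤ B.card + 1 := by
  classical
  have hne : Nonempty X := by
    obtain ⟨v, hv⟩ := Finset.card_eq_one.1 h1
    have : v ∈ (G.partialDual B).vertices := by rw [hv]; simp
    obtain ⟨x, -⟩ := (mem_vertices _ _).1 this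
    exact ⟨x⟩
  let q : X → {v // v ∈ G.vertices} := fun x => ⟨G.vertexOf x, (mem_vertices _ _).2 ⟨x, rfl⟩⟩
  have qt : ∀ x, q (G.th x) = q x := fun x => Subtype.ext (vertexOf_eq hG (G.th_mem_vertexOf x))
  have q0 : ∀ x, q (G.s0 x) = q x := fun x => Subtype.ext (vertexOf_eq hG (G.s0_mem_vertexOf x))
  let p : X → Sym2 {v // v ∈ G.vertices} := fun x => s(q x, q (G.s1 x))
  have pe : ∀ x y, y ∈ G.edgeOf x → p y = p x := by
    intro x y hy
    simp only [edgeOf, mem_insert, mem_singleton] at hy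
    rcases hy with rfl | rfl | rfl | rfl
    · rfl
    · simp only [p, ← hG.ts, qt]
    · simp only [p, hG.ss, Sym2.eq_swap]
    · simp only [p, hG.ss, ← hG.ts, qt, Sym2.eq_swap]
  let g : Finset X → Sym2 {v // v ∈ G.vertices} := fun e =>
    if h : e.Nonempty then p h.choose else p (Classical.choice hne)
  have hg : ∀ x, g (G.edgeOf x) = p x := by
    intro x
    have h : (G.edgeOf x).Nonempty := ⟨x, G.mem_edgeOf_self x⟩
    simp only [g, dif_pos h]
    exact pe _ _ h.choose_spec
  let Γ : SimpleGraph {v // v ∈ G.vertices} :=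
    SimpleGraph.fromEdgeSet ((B.image g : Finset _) : Set (Sym2 {v // v ∈ G.vertices}))
  have hreach : ∀ x y, Γ.Reachable (q x) (q y) := by
    refine one_vertex_rel hG hB h1 (fun x y => Γ.Reachable (q x) (q y)) (fun x => .refl _)
      (fun _ _ _ h1 h2 => h1.trans h2) ?_ ?_ ?_
    · intro z
      rw [q0]
    · intro z
      rw [qt]
    · intro z hz
      by_cases hzz : q z = q (G.s1 z)
      · rw [← hzz]
      · apply SimpleGraph.Adj.reachable
        rw [SimpleGraph.fromEdgeSet_adj]
        refine ⟨?_, hzz⟩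
        rw [Finset.mem_coe, mem_image]
        exact ⟨_, (mem_crossSet hG.toEdgeAx hB z).1 hz, hg z⟩
  have hΓ : Γ.Connected := by
    haveI : Nonempty {v // v ∈ G.vertices} := ⟨q (Classical.choice hne)⟩
    refine ⟨?_⟩
    rintro ⟨u, hu⟩ ⟨v, hv⟩
    obtain ⟨x, rfl⟩ := (mem_vertices _ _).1 hu
    obtain ⟨y, rfl⟩ := (mem_vertices _ _).1 hv
    exact hreach x y
  have := hΓ.card_vert_le_card_edgeSet_add_one
  rw [Nat.card_eq_fintype_card, Fintype.card_coe] at this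
  refine this.trans (Nat.add_le_add_right ?_ 1)
  have hsub : Γ.edgeSet ⊆ ((B.image g : Finset _) : Set (Sym2 {v // v ∈ G.vertices})) := by
    rw [SimpleGraph.edgeSet_fromEdgeSet]
    exact Set.diff_subset
  calc Nat.card Γ.edgeSet = Γ.edgeSet.ncard := rfl
    _ ≤ _ := Set.ncard_le_ncard hsub (Finset.finite_toSet _)
    _ = (B.image g).card := Set.ncard_coe_finset _
    _ ≤ B.card := card_image_le

end Boundary

lemma pow_factor (E A C : Finset (Finset X)) (hA : A ⊆ E) (hC : C ⊆ E)
    (θ : ℝ) (hθ : 0 < θ) (α : Finset X → ℝ) (hα : ∀ e ∈ E, α e ≠ 0) :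
    (θ / 2) ^ (symmDiff A C).card * ∏ e ∈ E \ symmDiff A C, α e =
      (∏ e ∈ A, 2 * α e / θ) * ((θ / 2) ^ C.card *
        ∏ e ∈ E \ C, (if e ∈ A then θ ^ 2 / (4 * α e) else α e)) := by
  have hD : symmDiff A C ⊆ E := by
    intro e he
    rcases mem_symmDiff.1 he with h | h
    · exact hA h.1
    · exact hC h.1
  have conv1 : ∀ (T : Finset (Finset X)) (f : Finset X → ℝ), T ⊆ E →
      ∏ e ∈ T, f e = ∏ e ∈ E, if e ∈ T then f e else 1 := by
    intro T f hT
    rw [Finset.prod_ite_mem, Finset.inter_eq_right.2 hT]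
  rw [← Finset.prod_const, ← Finset.prod_const, conv1 _ _ hD, conv1 _ _ sdiff_subset,
    conv1 A _ hA, conv1 C _ hC, conv1 (E \ C) _ sdiff_subset, ← prod_mul_distrib,
    ← prod_mul_distrib, ← prod_mul_distrib]
  refine Finset.prod_congr rfl fun e he => ?_
  have h0 := hα e he
  by_cases h1 : e ∈ A <;> by_cases h2 : e ∈ C <;> simp [h1, h2, he, mem_symmDiff] <;> field_simp
  norm_num

end Helpers

end RawRibbon

end RibbonPaper

open RibbonPaper RawRibbon in
/-- partial duality for the first Symanzik polynomial of the
noncommutative heat-kernel theory. -/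
theorem statement_16 {X : Type} [Fintype X] [DecidableEq X]
    (G : RawRibbon X) (hG : G.IsRibbon) (hnf : G.NoFlags) (hconn : G.Connected)
    (A : Finset (Finset X)) (hA : A ⊆ G.edges)
    (θ : ℝ) (hθ : 0 < θ) (α : Finset X → ℝ) (hα : ∀ e ∈ G.edges, α e ≠ 0) :
    Upoly (G.partialDual A) α θ =
      (θ / 2) ^ ((G.vertices.card : ℤ) - ((G.partialDual A).vertices.card : ℤ)) *
        (∏ e ∈ A, 2 * α e / θ) *
        Upoly G (fun e => if e ∈ A then θ ^ 2 / (4 * α e) else α e) θ := by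
  classical
  have hW := weakAx_of G hG hnf
  have hE := hW.toEdgeAx
  have hW' := pd_weakAx hW hA
  have hsub : ∀ {C : Finset (Finset X)}, C ⊆ G.edges → symmDiff A C ⊆ G.edges := by
    intro C hC e he
    rcases mem_symmDiff.1 he with h | h
    · exact hA h.1
    · exact hC h.1
  have hq : ∀ C ⊆ G.edges, ((G.partialDual A).IsQuasiTree (symmDiff A C) ↔ G.IsQuasiTree C) := by
    intro C hC
    rw [isQuasiTree_iff hW hC, isQuasiTree_iff hW' (by rw [pd_edges hE hA]; exact hsub hC),
      pd_pd hE hA (hsub hC), symmDiff_symmDiff_cancel_left]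
  rw [Upoly, Upoly, Finset.mul_sum, pd_edges hE hA]
  symm
  apply Finset.sum_bij' (fun C _ => symmDiff A C) (fun C _ => symmDiff A C)
  · intro C hC
    rw [mem_filter, mem_powerset] at hC ⊢
    exact ⟨hsub hC.1, (hq C hC.1).2 hC.2⟩
  · intro C hC
    rw [mem_filter, mem_powerset] at hC ⊢
    refine ⟨hsub hC.1, (hq _ (hsub hC.1)).1 ?_⟩
    rw [symmDiff_symmDiff_cancel_left]
    exact hC.2
  · intro C _
    exact symmDiff_symmDiff_cancel_left _ _
  · intro C _
    exact symmDiff_symmDiff_cancel_left _ _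
  · intro C hC
    rw [mem_filter, mem_powerset] at hC
    have hD : symmDiff A C ⊆ (G.partialDual A).edges := by
      rw [pd_edges hE hA]; exact hsub hC.1
    have l1 := card_vertices_le hW hC.1 ((isQuasiTree_iff hW hC.1).1 hC.2)
    have l2 := card_vertices_le hW' hD ((isQuasiTree_iff hW' hD).1 ((hq C hC.1).2 hC.2))
    have hpf := pow_factor G.edges A C hA hC.1 θ hθ α hα
    have ht : θ / 2 ≠ 0 := by positivity
    have z1 : (θ / 2) ^ (C.card + 1 - G.vertices.card) =
        (θ / 2) ^ C.card * (θ / 2) * ((θ / 2) ^ G.vertices.card)⁻¹ := by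
      rw [pow_sub₀ _ ht l1, pow_succ]
    have z2 : (θ / 2) ^ ((symmDiff A C).card + 1 - (G.partialDual A).vertices.card) =
        (θ / 2) ^ (symmDiff A C).card * (θ / 2) *
          ((θ / 2) ^ (G.partialDual A).vertices.card)⁻¹ := by
      rw [pow_sub₀ _ ht l2, pow_succ]
    rw [z1, z2, zpow_sub₀ ht, zpow_natCast, zpow_natCast]
    have hv : (θ / 2) ^ G.vertices.card ≠ 0 := pow_ne_zero _ ht
    generalize (θ / 2) ^ G.vertices.card = a at *
    generalize (θ / 2) ^ (G.partialDual A).vertices.card = b at *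
    calc _ = ((∏ e ∈ A, 2 * α e / θ) * ((θ / 2) ^ C.card *
        ∏ e ∈ G.edges \ C, (if e ∈ A then θ ^ 2 / (4 * α e) else α e))) * (θ / 2) * b⁻¹
          * (a * a⁻¹) := by ring
      _ = _ := by rw [← hpf, mul_inv_cancel₀ hv]; ring
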